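/- For every n ≥ 2, the number of permutations σ of [n] avoiding both of the patterns 123 and 312 in which the entry 2 appears to the left of the entry 1 (i.e., σ^{-1}(2) < σ^{-1}(1)) equals n(n−1)/2. -/

import Mathlib

/-- `σ` contains the pattern `τ`. -/
def ContainsPat {n k : ℕ} (σ : Equiv.Perm (Fin n)) (τ : Equiv.Perm (Fin k)) : Prop :=
  ∃ f : Fin k → Fin n, StrictMono f ∧ ∀ a b : Fin k, σ (f a) < σ (f b) ↔ τ a < τ b

/-- `σ` avoids every pattern in the set `B`. -/
def AvoidsAll {n : ℕ} (B : Set (Σ k, Equiv.Perm (Fin k))) (σ : Equiv.Perm (Fin n)) : Prop :=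
  ∀ p ∈ B, ¬ ContainsPat σ p.2

/-- The pattern 123 (0-based one-line notation). -/
noncomputable def p123 : Equiv.Perm (Fin 3) :=
  Equiv.ofBijective ![0, 1, 2] (by decide)

/-- The pattern 312 (0-based one-line notation). -/
noncomputable def p312 : Equiv.Perm (Fin 3) :=
  Equiv.ofBijective ![2, 0, 1] (by decide)

/-- Explicit one-line notation: three decreasing blocks. -/
def gg (n a b i : ℕ) : ℕ :=
  if i + a < b then b - 1 - i else if i + a < n then n - 1 + b - a - i else n - 1 - i

theorem gg_lt (n a b i : ℕ) (h1 : a < b) (h2 : b ≤ n) (hi : i < n) : gg n a b i < n := by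
  unfold gg; split_ifs <;> omega

theorem gg_inj (n a b i j : ℕ) (h1 : a < b) (h2 : b ≤ n) (hi : i < n) (hj : j < n)
    (h : gg n a b i = gg n a b j) : i = j := by
  unfold gg at h; split_ifs at h <;> omega

noncomputable def ff (n a b : ℕ) (h1 : a < b) (h2 : b ≤ n) : Equiv.Perm (Fin n) :=
  Equiv.ofBijective (fun i => ⟨gg n a b i, gg_lt n a b i h1 h2 i.2⟩)
    (Finite.injective_iff_bijective.1 (fun i j h =>
      Fin.ext (gg_inj n a b i j h1 h2 i.2 j.2 (by simpa using h))))

theorem ff_val (n a b : ℕ) (h1 : a < b) (h2 : b ≤ n) (i : Fin n) :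
    (ff n a b h1 h2 i : ℕ) = gg n a b i := rfl

theorem avoids_iff {n : ℕ} (σ : Equiv.Perm (Fin n)) :
    AvoidsAll ({⟨3, p123⟩, ⟨3, p312⟩} : Set (Σ k, Equiv.Perm (Fin k))) σ ↔
    (∀ i j k : Fin n, i < j → j < k → ¬ (σ i < σ j ∧ σ j < σ k)) ∧
    (∀ i j k : Fin n, i < j → j < k → ¬ (σ j < σ k ∧ σ k < σ i)) := by
  have mono : ∀ i j k : Fin n, i < j → j < k → StrictMono ![i, j, k] := by
    intro i j k h1 h2 x y hxy
    fin_cases x <;> fin_cases y <;> simp at hxy ⊢ <;> order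
  constructor
  · intro h
    constructor
    · rintro i j k hij hjk ⟨h1, h2⟩
      refine h ⟨3, p123⟩ (by simp) ⟨![i, j, k], mono i j k hij hjk, ?_⟩
      intro x y
      fin_cases x <;> fin_cases y <;> simp [p123] <;> order
    · rintro i j k hij hjk ⟨h1, h2⟩
      refine h ⟨3, p312⟩ (by simp) ⟨![i, j, k], mono i j k hij hjk, ?_⟩
      intro x y
      fin_cases x <;> fin_cases y <;> simp [p312] <;> order
  · rintro ⟨h1, h2⟩ p hp ⟨f, hf, hp2⟩
    simp only [Set.mem_insert_iff, Set.mem_singleton_iff] at hp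
    rcases hp with rfl | rfl
    · exact h1 (f 0) (f 1) (f 2) (hf (by decide)) (hf (by decide))
        ⟨(hp2 0 1).2 (by simp [p123]), (hp2 1 2).2 (by simp [p123])⟩
    · exact h2 (f 0) (f 1) (f 2) (hf (by decide)) (hf (by decide))
        ⟨(hp2 1 2).2 (by simp [p312]), (hp2 2 0).2 (by simp [p312])⟩

theorem ff_avoids (n a b : ℕ) (h1 : a < b) (h2 : b ≤ n) :
    AvoidsAll ({⟨3, p123⟩, ⟨3, p312⟩} : Set (Σ k, Equiv.Perm (Fin k))) (ff n a b h1 h2) := by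
  rw [avoids_iff]
  simp only [Fin.lt_def, ff_val]
  constructor
  · rintro ⟨i, hi⟩ ⟨j, hj⟩ ⟨k, hk⟩ hij hjk ⟨h3, h4⟩
    simp only [gg] at *
    split_ifs at h3 h4 <;> omega
  · rintro ⟨i, hi⟩ ⟨j, hj⟩ ⟨k, hk⟩ hij hjk ⟨h3, h4⟩
    simp only [gg] at *
    split_ifs at h3 h4 <;> omega

theorem ff_two_one (n a b : ℕ) (h1 : a < b) (h2 : b ≤ n) (hn : 2 ≤ n) (k1 : 1 < n) (k0 : 0 < n) (hb : b ≠ 1) :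
    (ff n a b h1 h2).symm ⟨1, k1⟩ < (ff n a b h1 h2).symm ⟨0, k0⟩ := by
  obtain ⟨x, hx⟩ : ∃ x, x = (ff n a b h1 h2).symm ⟨1, k1⟩ := ⟨_, rfl⟩
  obtain ⟨y, hy⟩ : ∃ y, y = (ff n a b h1 h2).symm ⟨0, k0⟩ := ⟨_, rfl⟩
  rw [← hx, ← hy]
  rw [Equiv.eq_symm_apply, Fin.ext_iff, ff_val] at hx hy
  obtain ⟨x, hx'⟩ := x
  obtain ⟨y, hy'⟩ := y
  simp only [gg, Fin.lt_def] at *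
  split_ifs at hx hy <;> omega

theorem gg_par_inj (n a b a' b' : ℕ) (h1 : a < b) (h2 : b ≤ n) (h1' : a' < b') (h2' : b' ≤ n)
    (hz : b = n → a = 0) (hz' : b' = n → a' = 0)
    (h : ∀ i < n, gg n a b i = gg n a' b' i) : a = a' ∧ b = b' := by
  have e0 := h 0 (by omega)
  have hb : b = b' := by
    unfold gg at e0; split_ifs at e0 <;> omega
  subst hb
  by_cases hbn : b = n
  · omega
  · have e1 := h (b - a) (by omega)
    have e2 := h (b - a') (by omega)
    unfold gg at e1 e2; split_ifs at e1 e2 <;> omega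

/-- An avoider whose maximum sits at position `p` is determined. -/
theorem avoid_eq (n a b p : ℕ) (σ : Equiv.Perm (Fin n)) (h1 : a < b) (h2 : b ≤ n) (hn : 0 < n)
    (H1 : ∀ i j k : Fin n, i < j → j < k → ¬ (σ i < σ j ∧ σ j < σ k))
    (H2 : ∀ i j k : Fin n, i < j → j < k → ¬ (σ j < σ k ∧ σ k < σ i))
    (h0 : (σ ⟨0, hn⟩ : ℕ) + 1 = b) (hp : p < n) (hpn : (σ ⟨p, hp⟩ : ℕ) + 1 = n)
    (hpab : b = n ∧ a = 0 ∧ p = 0 ∨ b < n ∧ a + p = b) :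
    σ = ff n a b h1 h2 := by
  have inj : ∀ i j : Fin n, (σ i : ℕ) = σ j → (i : ℕ) = j := fun i j h =>
    congrArg Fin.val (σ.injective (Fin.ext h))
  have key : ∀ i (hi : i < n), (σ ⟨i, hi⟩ : ℕ) = gg n a b i := by
    intro i
    induction i using Nat.strong_induction_on with
    | _ i ih =>
    intro hi
    obtain ⟨⟨k, hk⟩, hk2⟩ := σ.surjective ⟨gg n a b i, gg_lt n a b i h1 h2 hi⟩
    have hk3 : (σ ⟨k, hk⟩ : ℕ) = gg n a b i := by rw [hk2]
    obtain ⟨⟨m, hm⟩, hm2⟩ := (ff n a b h1 h2).surjective (σ ⟨i, hi⟩)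
    have hm3 : gg n a b m = (σ ⟨i, hi⟩ : ℕ) := by rw [← hm2]; rfl
    have hki : ¬ k < i := by
      intro hki
      have := gg_inj n a b k i h1 h2 hk hi (by rw [← ih k hki hk, hk3])
      omega
    have hmi : ¬ m < i := by
      intro hmi
      have := inj ⟨m, hm⟩ ⟨i, hi⟩ (by rw [ih m hmi hm, hm3])
      simp at this; omega
    by_cases hik : k = i
    · subst hik; exact hk3
    have g0 : gg n a b 0 = b - 1 := by
      unfold gg; split_ifs <;> omega
    have i0 : i ≠ 0 := by
      rintro rfl
      have := inj ⟨k, hk⟩ ⟨0, hn⟩ (by omega)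
      simp at this; omega
    have c1 := H2 ⟨0, hn⟩ ⟨i, hi⟩ ⟨k, hk⟩ (by simp [Fin.lt_def]; omega) (by simp [Fin.lt_def]; omega)
    have c2 : p < i → ¬ ((σ ⟨i, hi⟩ : ℕ) < σ ⟨k, hk⟩ ∧ (σ ⟨k, hk⟩ : ℕ) < σ ⟨p, hp⟩) := fun h =>
      H2 ⟨p, hp⟩ ⟨i, hi⟩ ⟨k, hk⟩ (by simpa [Fin.lt_def]) (by simp [Fin.lt_def]; omega)
    have c3 : i < p → ¬ ((σ ⟨0, hn⟩ : ℕ) < σ ⟨i, hi⟩ ∧ (σ ⟨i, hi⟩ : ℕ) < σ ⟨p, hp⟩) := fun h =>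
      H1 ⟨0, hn⟩ ⟨i, hi⟩ ⟨p, hp⟩ (by simp [Fin.lt_def]; omega) (by simpa [Fin.lt_def])
    have d1 : (σ ⟨i, hi⟩ : ℕ) ≠ σ ⟨k, hk⟩ := fun h => by
      have := inj _ _ h; simp at this; omega
    have d2 : (σ ⟨k, hk⟩ : ℕ) ≠ σ ⟨p, hp⟩ ∨ k = p := by
      by_cases h : k = p
      · exact Or.inr h
      · exact Or.inl fun h' => h (inj _ _ h')
    have d3 : (σ ⟨i, hi⟩ : ℕ) ≠ σ ⟨0, hn⟩ := fun h => by
      have := inj _ _ h; simp at this; omega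
    have d4 : (σ ⟨i, hi⟩ : ℕ) ≠ σ ⟨p, hp⟩ ∨ i = p := by
      by_cases h : i = p
      · exact Or.inr h
      · exact Or.inl fun h' => h (inj _ _ h')
    have d5 := (σ ⟨i, hi⟩).2
    have d6 : i = p → (σ ⟨i, hi⟩ : ℕ) = σ ⟨p, hp⟩ := by rintro rfl; rfl
    simp only [Fin.lt_def] at c1
    generalize (σ ⟨i, hi⟩ : ℕ) = si at *
    generalize (σ ⟨k, hk⟩ : ℕ) = sk at *
    generalize (σ ⟨0, hn⟩ : ℕ) = s0 at *
    generalize (σ ⟨p, hp⟩ : ℕ) = sp at *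
    clear H1 H2 ih inj hk2 hm2 g0
    exfalso
    unfold gg at hk3 hm3
    split_ifs at hk3 hm3 <;> omega
  ext i
  rw [ff_val]; exact key i i.2

theorem avoid_exists (n : ℕ) (hn : 2 ≤ n) (k1 : 1 < n) (k0 : 0 < n) (σ : Equiv.Perm (Fin n))
    (H1 : ∀ i j k : Fin n, i < j → j < k → ¬ (σ i < σ j ∧ σ j < σ k))
    (H2 : ∀ i j k : Fin n, i < j → j < k → ¬ (σ j < σ k ∧ σ k < σ i))
    (H3 : σ.symm ⟨1, k1⟩ < σ.symm ⟨0, k0⟩) :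
    ∃ a b, ∃ (h1 : a < b) (h2 : b ≤ n), (b = n → a = 0) ∧ b ≠ 1 ∧ ff n a b h1 h2 = σ := by
  have hn0 : 0 < n := by omega
  obtain ⟨⟨p, hp⟩, hp2⟩ := σ.surjective ⟨n - 1, by omega⟩
  have hpn : (σ ⟨p, hp⟩ : ℕ) + 1 = n := by rw [hp2]; simp; omega
  have hlt := (σ ⟨0, hn0⟩).2
  have hb1 : (σ ⟨0, hn0⟩ : ℕ) + 1 ≠ 1 := by
    intro h
    have : σ.symm ⟨0, k0⟩ = ⟨0, hn0⟩ := by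
      rw [Equiv.symm_apply_eq]; apply Fin.ext; simp; omega
    rw [this] at H3
    simp [Fin.lt_def] at H3
  by_cases hbn : (σ ⟨0, hn0⟩ : ℕ) + 1 = n
  · have : p = 0 := by
      have := σ.injective (Fin.ext (by omega) : σ ⟨p, hp⟩ = σ ⟨0, hn0⟩)
      simpa using this
    refine ⟨0, (σ ⟨0, hn0⟩ : ℕ) + 1, by omega, by omega, by omega, hb1, ?_⟩
    exact (avoid_eq n 0 _ p σ _ _ hn0 H1 H2 rfl hp hpn (by omega)).symm
  · have hp0 : p ≠ 0 := by
      rintro rfl; omega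
    have dec : ∀ i (hi : i < p), (σ ⟨i, by omega⟩ : ℕ) + i ≤ σ ⟨0, hn0⟩ := by
      intro i
      induction i with
      | zero => intro _; simp
      | succ i ih =>
        intro hi
        have e := ih (by omega)
        have c := H1 ⟨i, by omega⟩ ⟨i + 1, by omega⟩ ⟨p, hp⟩ (by simp [Fin.lt_def]) (by simpa [Fin.lt_def])
        have d1 : (σ ⟨i + 1, by omega⟩ : ℕ) ≠ σ ⟨p, hp⟩ := fun h => by
          have := σ.injective (Fin.ext h); simp at this; omega
        have d2 : (σ ⟨i + 1, by omega⟩ : ℕ) ≠ σ ⟨i, by omega⟩ := fun h => by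
          have := σ.injective (Fin.ext h); simp at this
        have d3 := (σ ⟨i + 1, by omega⟩).2
        simp only [Fin.lt_def] at c
        omega
    have := dec (p - 1) (by omega)
    refine ⟨(σ ⟨0, hn0⟩ : ℕ) + 1 - p, (σ ⟨0, hn0⟩ : ℕ) + 1, by omega, by omega, by omega, hb1, ?_⟩
    exact (avoid_eq n _ _ p σ _ _ hn0 H1 H2 rfl hp hpn (by omega)).symm

theorem card_avoiders_123_312_two_before_one (n : ℕ) (hn : 2 ≤ n) :
    Nat.card {σ : Equiv.Perm (Fin n) //
        AvoidsAll ({⟨3, p123⟩, ⟨3, p312⟩} : Set (Σ k, Equiv.Perm (Fin k))) σ ∧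
        σ.symm ⟨1, by omega⟩ < σ.symm ⟨0, by omega⟩} =
      n * (n - 1) / 2 := by
  have hQ : Nat.card (Σ b : Fin n, Fin b) = n * (n - 1) / 2 := by
    rw [Nat.card_eq_fintype_card, Fintype.card_sigma]
    simp only [Fintype.card_fin]
    rw [Fin.sum_univ_eq_sum_range (fun i => i) n, Finset.sum_range_id]
  rw [← hQ]
  symm
  have A : ∀ x : (Σ b : Fin n, Fin b), (x.2 : ℕ) < if (x.1 : ℕ) = 1 then n else x.1 := by
    intro x; have := x.2.2; split_ifs <;> omega
  have B : ∀ x : (Σ b : Fin n, Fin b), (if (x.1 : ℕ) = 1 then n else x.1) ≤ n := by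
    intro x; have := x.1.2; split_ifs <;> omega
  have C : ∀ x : (Σ b : Fin n, Fin b), (if (x.1 : ℕ) = 1 then n else x.1) ≠ 1 := by
    intro x; split_ifs <;> omega
  have D : ∀ x : (Σ b : Fin n, Fin b), (if (x.1 : ℕ) = 1 then n else x.1) = n → (x.2 : ℕ) = 0 := by
    intro x; have := x.2.2; have := x.1.2; split_ifs <;> omega
  refine Nat.card_eq_of_bijective (fun x => ⟨ff n x.2 _ (A x) (B x),
    ff_avoids _ _ _ _ _, ff_two_one _ _ _ _ _ hn _ _ (C x)⟩) ⟨?_, ?_⟩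
  · intro x y hxy
    have h := congrArg Subtype.val hxy
    obtain ⟨e1, e2⟩ := gg_par_inj n _ _ _ _ (A x) (B x) (A y) (B y) (D x) (D y) (by
      intro i hi
      have := congrArg (fun s : Equiv.Perm (Fin n) => (s ⟨i, hi⟩ : ℕ)) h
      exact this)
    obtain ⟨⟨b, hb⟩, ⟨a, ha⟩⟩ := x
    obtain ⟨⟨b', hb'⟩, ⟨a', ha'⟩⟩ := y
    simp only at e1 e2 ha ha'
    have : b = b' := by split_ifs at e2 <;> omega
    subst this
    subst e1
    rfl
  · rintro ⟨σ, h, h3⟩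
    obtain ⟨H1, H2⟩ := (avoids_iff σ).1 h
    obtain ⟨a, b, h1, h2, h4, h5, rfl⟩ := avoid_exists n hn _ _ σ H1 H2 h3
    by_cases hb : b = n
    · have ha := h4 hb
      subst hb ha
      refine ⟨⟨⟨1, by omega⟩, ⟨0, by simp⟩⟩, ?_⟩
      apply Subtype.ext
      simp
    · refine ⟨⟨⟨b, by omega⟩, ⟨a, h1⟩⟩, ?_⟩
      apply Subtype.ext
      simp [h5]
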